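/- Suppose the linear operator 𝒜 : ℝ^{m×n} → ℝ^d, 𝒜(X)_i = tr(A_iᵀX), satisfies 2k-RIP with constant δ_{2k}. Then for any U₁, U₂ ∈ ℝ^{m×k} and V₁, V₂ ∈ ℝ^{n×k}, |⟨𝒜(U₁V₁ᵀ), 𝒜(U₂V₂ᵀ)⟩ − Tr(U₂ᵀU₁V₁ᵀV₂)| ≤ 3δ_{2k} ‖U₁V₁ᵀ‖_F ‖U₂V₂ᵀ‖_F. -/

import Mathlib

open Matrix MeasureTheory Finset

noncomputable section

namespace AltMin

/-- Euclidean norm of a finitely-indexed real vector. -/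
def euclNorm {ι : Type*} [Fintype ι] (v : ι → ℝ) : ℝ :=
  Real.sqrt (∑ i, v i ^ 2)

/-- Frobenius norm of a real matrix. -/
def frobNorm {ι κ : Type*} [Fintype ι] [Fintype κ] (A : Matrix ι κ ℝ) : ℝ :=
  Real.sqrt (∑ i, ∑ j, A i j ^ 2)

/-- Spectral norm of a real matrix. -/
def specNorm {ι κ : Type*} [Fintype ι] [Fintype κ] (A : Matrix ι κ ℝ) : ℝ :=
  sSup {r : ℝ | ∃ v : κ → ℝ, euclNorm v = 1 ∧ r = euclNorm (A.mulVec v)}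

/-- Minimum singular value of a square real matrix. -/
def minSingVal {ι : Type*} [Fintype ι] (A : Matrix ι ι ℝ) : ℝ :=
  sInf {r : ℝ | ∃ v : ι → ℝ, euclNorm v = 1 ∧ r = euclNorm (A.mulVec v)}

/-- Orthogonal projection onto the column span of a (full column rank) matrix. -/
def colProj {m k : ℕ} (W : Matrix (Fin m) (Fin k) ℝ) : Matrix (Fin m) (Fin m) ℝ :=
  W * (Wᵀ * W)⁻¹ * Wᵀ

/-- Principal-angle distance `dist(W₁, W₂) = ‖(W₁⊥)ᵀ W₂‖₂` between column spans,
expressed basis-independently via orthogonal projections. -/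
def matDist {m k₁ k₂ : ℕ} (W₁ : Matrix (Fin m) (Fin k₁) ℝ)
    (W₂ : Matrix (Fin m) (Fin k₂) ℝ) : ℝ :=
  specNorm ((1 - colProj W₁) * colProj W₂)

/-- The linear measurement operator `𝒜(X)ᵢ = tr(Aᵢᵀ X)`. -/
def sense {m n d : ℕ} (A : Fin d → Matrix (Fin m) (Fin n) ℝ)
    (X : Matrix (Fin m) (Fin n) ℝ) : Fin d → ℝ :=
  fun i => ((A i)ᵀ * X).trace

/-- The adjoint `𝒜ᵀ(y) = ∑ i, yᵢ Aᵢ` of the measurement operator. -/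
def senseAdj {m n d : ℕ} (A : Fin d → Matrix (Fin m) (Fin n) ℝ) (y : Fin d → ℝ) :
    Matrix (Fin m) (Fin n) ℝ :=
  ∑ i, y i • A i

/-- `k`-restricted isometry property with constant `δ`. -/
def RIP {m n d : ℕ} (A : Fin d → Matrix (Fin m) (Fin n) ℝ) (k : ℕ) (δ : ℝ) : Prop :=
  ∀ X : Matrix (Fin m) (Fin n) ℝ, X.rank ≤ k →
    (1 - δ) * frobNorm X ^ 2 ≤ euclNorm (sense A X) ^ 2 ∧
      euclNorm (sense A X) ^ 2 ≤ (1 + δ) * frobNorm X ^ 2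

/-- `U` consists of top-`k` left singular vectors of `Y`:  `U` has orthonormal columns and
maximizes `‖U'ᵀ Y‖_F` over all matrices with orthonormal columns. -/
def IsTopKLeftSing {m n k : ℕ} (Y : Matrix (Fin m) (Fin n) ℝ)
    (U : Matrix (Fin m) (Fin k) ℝ) : Prop :=
  Uᵀ * U = 1 ∧ ∀ U' : Matrix (Fin m) (Fin k) ℝ, U'ᵀ * U' = 1 →
    frobNorm (U'ᵀ * Y) ≤ frobNorm (Uᵀ * Y)

/-- `Z` is a best rank-`i` approximation of `Y` in Frobenius norm
(the top-`i` singular components of `Y`). -/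
def IsBestRankApprox {m n : ℕ} (Y Z : Matrix (Fin m) (Fin n) ℝ) (i : ℕ) : Prop :=
  Z.rank ≤ i ∧ ∀ W : Matrix (Fin m) (Fin n) ℝ, W.rank ≤ i →
    frobNorm (Y - Z) ≤ frobNorm (Y - W)

/-- `P_Ω`: keep the entries in `Ω`, zero out the rest. -/
def projO {m n : ℕ} (Ω : Set (Fin m × Fin n)) (X : Matrix (Fin m) (Fin n) ℝ) :
    Matrix (Fin m) (Fin n) ℝ :=
  fun i j => Set.indicator Ω (fun _ => X i j) (i, j)

/-- Clip to zero all entries of magnitude greater than `θ`. -/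
def clip {m k : ℕ} (θ : ℝ) (W : Matrix (Fin m) (Fin k) ℝ) : Matrix (Fin m) (Fin k) ℝ :=
  fun i j => if θ < |W i j| then 0 else W i j

/-- Bernoulli measure with parameter `p` on `Bool`. -/
def bernoulliMeasure (p : ℝ) : Measure Bool :=
  ENNReal.ofReal p • Measure.dirac true + ENNReal.ofReal (1 - p) • Measure.dirac false

/-- Each entry of an `m × n` matrix is observed independently with probability `p`. -/
def sampleMeasure (m n : ℕ) (p : ℝ) : Measure ((Fin m × Fin n) → Bool) :=
  Measure.pi fun _ => bernoulliMeasure p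

instance optionMeasurableSpace {α : Type*} : MeasurableSpace (Option α) := ⊤

/-- Each entry is (independently) unobserved with probability `1 - p`, and observed and
assigned to one of `K` buckets uniformly otherwise. -/
def partMeasure (K : ℕ) (p : ℝ) : Measure (Option (Fin K)) :=
  ENNReal.ofReal (1 - p) • Measure.dirac none +
    ∑ t : Fin K, ENNReal.ofReal (p / K) • Measure.dirac (some t)

/-- Product sampling measure for the partitioned-observation model. -/
def partSampleMeasure (m n K : ℕ) (p : ℝ) : Measure ((Fin m × Fin n) → Option (Fin K)) :=
  Measure.pi fun _ => partMeasure K p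

/-- The `j`-th bucket of observed entries. -/
def partSet {m n K : ℕ} (ω : Fin m × Fin n → Option (Fin K)) (j : ℕ) :
    Set (Fin m × Fin n) :=
  {q | Option.map Fin.val (ω q) = some j}

end AltMin

namespace AltMin

/-- The polarization of `‖𝒜(X)‖² - ‖X‖²`. -/
def ripDefect {m n d : ℕ} (A : Fin d → Matrix (Fin m) (Fin n) ℝ)
    (X Y : Matrix (Fin m) (Fin n) ℝ) : ℝ :=
  (∑ i, sense A X i * sense A Y i) - (Yᵀ * X).trace

lemma euclNorm_sq {ι : Type*} [Fintype ι] (v : ι → ℝ) : euclNorm v ^ 2 = ∑ i, v i * v i := by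
  rw [euclNorm, Real.sq_sqrt (by positivity)]
  simp only [sq]

lemma frobNorm_sq {ι κ : Type*} [Fintype ι] [Fintype κ] (X : Matrix ι κ ℝ) :
    frobNorm X ^ 2 = (Xᵀ * X).trace := by
  rw [frobNorm, Real.sq_sqrt (by positivity), Finset.sum_comm]
  simp only [sq, Matrix.trace, Matrix.diag, Matrix.mul_apply, Matrix.transpose_apply]

lemma eq_zero_of_frobNorm_eq_zero {ι κ : Type*} [Fintype ι] [Fintype κ] {X : Matrix ι κ ℝ}
    (h : frobNorm X = 0) : X = 0 := by
  rw [frobNorm, Real.sqrt_eq_zero (by positivity)] at h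
  ext i j
  rw [Finset.sum_eq_zero_iff_of_nonneg (fun _ _ => by positivity)] at h
  have hi := h i (Finset.mem_univ i)
  rw [Finset.sum_eq_zero_iff_of_nonneg (fun _ _ => by positivity)] at hi
  simpa using hi j (Finset.mem_univ j)

section Defect

variable {m n d : ℕ} (A : Fin d → Matrix (Fin m) (Fin n) ℝ)

lemma ripDefect_comm (X Y : Matrix (Fin m) (Fin n) ℝ) :
    ripDefect A X Y = ripDefect A Y X := by
  have h : (Yᵀ * X).trace = (Xᵀ * Y).trace := by
    rw [← Matrix.trace_transpose, Matrix.transpose_mul, Matrix.transpose_transpose]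
  simp only [ripDefect, h, mul_comm]

lemma sense_add (X Y : Matrix (Fin m) (Fin n) ℝ) : sense A (X + Y) = sense A X + sense A Y := by
  ext i
  simp [sense, Matrix.mul_add]

lemma sense_smul (a : ℝ) (X : Matrix (Fin m) (Fin n) ℝ) : sense A (a • X) = a • sense A X := by
  ext i
  simp [sense]

lemma ripDefect_add_left (X Y Z : Matrix (Fin m) (Fin n) ℝ) :
    ripDefect A (X + Y) Z = ripDefect A X Z + ripDefect A Y Z := by
  simp only [ripDefect, sense_add, Pi.add_apply, add_mul, Finset.sum_add_distrib,
    Matrix.mul_add, Matrix.trace_add]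
  ring

lemma ripDefect_smul_left (a : ℝ) (X Y : Matrix (Fin m) (Fin n) ℝ) :
    ripDefect A (a • X) Y = a * ripDefect A X Y := by
  simp only [ripDefect, sense_smul, Pi.smul_apply, smul_eq_mul, mul_assoc, ← Finset.mul_sum,
    Matrix.mul_smul, Matrix.trace_smul]
  ring

lemma ripDefect_self_smul_add_smul (a b : ℝ) (X Y : Matrix (Fin m) (Fin n) ℝ) :
    ripDefect A (a • X + b • Y) (a • X + b • Y) =
      a ^ 2 * ripDefect A X X + 2 * (a * b) * ripDefect A X Y + b ^ 2 * ripDefect A Y Y := by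
  have h (Z : Matrix (Fin m) (Fin n) ℝ) :
      ripDefect A Z (a • X + b • Y) = a * ripDefect A X Z + b * ripDefect A Y Z := by
    rw [ripDefect_comm, ripDefect_add_left, ripDefect_smul_left, ripDefect_smul_left]
  rw [ripDefect_add_left, ripDefect_smul_left, ripDefect_smul_left, h, h, ripDefect_comm A Y X]
  ring

lemma frobNorm_sq_smul_add_add_smul_sub (a b : ℝ) (X Y : Matrix (Fin m) (Fin n) ℝ) :
    frobNorm (a • X + b • Y) ^ 2 + frobNorm (a • X + (-b) • Y) ^ 2 =
      2 * (a ^ 2 * frobNorm X ^ 2 + b ^ 2 * frobNorm Y ^ 2) := by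
  simp only [frobNorm_sq, Matrix.transpose_add, Matrix.transpose_smul, Matrix.add_mul,
    Matrix.mul_add, Matrix.smul_mul, Matrix.mul_smul, Matrix.trace_add, Matrix.trace_smul,
    smul_eq_mul]
  ring

variable {A}

lemma RIP.abs_ripDefect_self_le {r : ℕ} {δ : ℝ} (h : RIP A r δ) {X : Matrix (Fin m) (Fin n) ℝ}
    (hX : X.rank ≤ r) : |ripDefect A X X| ≤ δ * frobNorm X ^ 2 := by
  obtain ⟨h₁, h₂⟩ := h X hX
  rw [ripDefect, ← euclNorm_sq, ← frobNorm_sq, abs_le]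
  constructor <;> linarith

/-- If every linear combination of `X` and `Y` satisfies the rank bound, the restricted isometry
property controls the deviation of inner products. -/
lemma RIP.abs_ripDefect_le {r : ℕ} {δ : ℝ} (h : RIP A r δ) {X Y : Matrix (Fin m) (Fin n) ℝ}
    (hXY : ∀ a b : ℝ, (a • X + b • Y).rank ≤ r) :
    |ripDefect A X Y| ≤ δ * frobNorm X * frobNorm Y := by
  rcases eq_or_ne (frobNorm X) 0 with hX | hX
  · have h₀ := ripDefect_smul_left A 0 X Y
    rw [zero_smul, zero_mul, ← eq_zero_of_frobNorm_eq_zero hX] at h₀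
    simp [h₀, hX]
  rcases eq_or_ne (frobNorm Y) 0 with hY | hY
  · have h₀ := ripDefect_smul_left A 0 Y X
    rw [zero_smul, zero_mul, ← eq_zero_of_frobNorm_eq_zero hY, ripDefect_comm] at h₀
    simp [h₀, hY]
  have hpos : 0 < frobNorm X * frobNorm Y :=
    mul_pos ((Real.sqrt_nonneg _).lt_of_ne' hX) ((Real.sqrt_nonneg _).lt_of_ne' hY)
  have h₁ := abs_le.1 (h.abs_ripDefect_self_le (hXY (frobNorm Y) (frobNorm X)))
  have h₂ := abs_le.1 (h.abs_ripDefect_self_le (hXY (frobNorm Y) (-frobNorm X)))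
  have hpar := congrArg (δ * ·) (frobNorm_sq_smul_add_add_smul_sub (frobNorm Y) (frobNorm X) X Y)
  simp only [ripDefect_self_smul_add_smul] at h₁ h₂
  refine le_of_mul_le_mul_left ?_ hpos
  rw [← abs_of_pos hpos, ← abs_mul, abs_of_pos hpos, abs_le]
  constructor <;> linarith

lemma RIP.mul_frobNorm_nonneg {r : ℕ} {δ : ℝ} (h : RIP A r δ) {X : Matrix (Fin m) (Fin n) ℝ}
    (hX : X.rank ≤ r) : 0 ≤ δ * frobNorm X := by
  have hnorm : 0 ≤ frobNorm X := Real.sqrt_nonneg _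
  rcases hnorm.eq_or_lt with h₀ | h₀
  · rw [← h₀, mul_zero]
  · exact le_of_mul_le_mul_right (by linarith [(abs_nonneg _).trans (h.abs_ripDefect_self_le hX)]) h₀

end Defect

lemma rank_smul_mul_add_smul_mul_le {m n k : ℕ} (U₁ U₂ : Matrix (Fin m) (Fin k) ℝ)
    (V₁ V₂ : Matrix (Fin n) (Fin k) ℝ) (a b : ℝ) :
    (a • (U₁ * V₁ᵀ) + b • (U₂ * V₂ᵀ)).rank ≤ 2 * k := by
  rw [← Matrix.smul_mul, ← Matrix.smul_mul, ← Matrix.fromCols_mul_fromRows]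
  refine (Matrix.rank_mul_le_left _ _).trans ((Matrix.rank_le_card_width _).trans_eq ?_)
  rw [Fintype.card_sum, Fintype.card_fin, two_mul]

/-- Lemma: RIP preserves inner products of rank-`k` factored matrices:
if `𝒜` satisfies `2k`-RIP with constant `δ_{2k}`, then for all `U₁, U₂ ∈ ℝ^{m×k}` and
`V₁, V₂ ∈ ℝ^{n×k}`,
`|⟨𝒜(U₁V₁ᵀ), 𝒜(U₂V₂ᵀ)⟩ − Tr(U₂ᵀU₁V₁ᵀV₂)| ≤ 3 δ_{2k} ‖U₁V₁ᵀ‖_F ‖U₂V₂ᵀ‖_F`. -/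
theorem rip_inner_product
    (m n d k : ℕ)
    (A : Fin d → Matrix (Fin m) (Fin n) ℝ)
    (δ : ℝ)
    (hRIP : RIP A (2 * k) δ) :
    ∀ (U₁ U₂ : Matrix (Fin m) (Fin k) ℝ) (V₁ V₂ : Matrix (Fin n) (Fin k) ℝ),
      |(∑ i, sense A (U₁ * V₁ᵀ) i * sense A (U₂ * V₂ᵀ) i) -
          (U₂ᵀ * U₁ * V₁ᵀ * V₂).trace| ≤
        3 * δ * frobNorm (U₁ * V₁ᵀ) * frobNorm (U₂ * V₂ᵀ) := by
  intro U₁ U₂ V₁ V₂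
  have hrank := rank_smul_mul_add_smul_mul_le U₁ U₂ V₁ V₂
  have htrace : (U₂ᵀ * U₁ * V₁ᵀ * V₂).trace = ((U₂ * V₂ᵀ)ᵀ * (U₁ * V₁ᵀ)).trace := by
    rw [Matrix.trace_mul_comm, Matrix.transpose_mul, Matrix.transpose_transpose]
    simp only [Matrix.mul_assoc]
  have hX : (U₁ * V₁ᵀ).rank ≤ 2 * k := by simpa using hrank 1 0
  have hnonneg : 0 ≤ δ * frobNorm (U₁ * V₁ᵀ) * frobNorm (U₂ * V₂ᵀ) :=
    mul_nonneg (hRIP.mul_frobNorm_nonneg hX) (Real.sqrt_nonneg _)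
  have hmain := hRIP.abs_ripDefect_le hrank
  rw [ripDefect, ← htrace] at hmain
  linarith

end AltMin
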